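/- Let G be a finite simple bipartite graph with bipartition (U, W), and let G' be the graph on the same vertex set whose edges are the edges of G together with all pairs of distinct vertices of U. Then U admits a nested neighborhood ordering in G (i.e., G is a bipartite chain graph with this bipartition) if and only if G' is a threshold graph. -/

import Mathlib

open SimpleGraph

/-- The graph `2K₂`: four vertices `{0,1,2,3}` with exactly the two edges `0-1` and `2-3`. -/
def twoK2 : SimpleGraph (Fin 4) := SimpleGraph.fromEdgeSet {s(0, 1), s(2, 3)}

/-- `G` contains an induced subgraph isomorphic to `H`. -/
def HasInducedSubgraph {V W : Type*} (G : SimpleGraph V) (H : SimpleGraph W) : Prop :=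
  ∃ s : Set V, Nonempty (G.induce s ≃g H)

/-- `G` is a threshold graph: it has no induced subgraph isomorphic to `2K₂`, `P₄`
or `C₄`. -/
def IsThreshold {V : Type*} (G : SimpleGraph V) : Prop :=
  ¬ HasInducedSubgraph G twoK2 ∧ ¬ HasInducedSubgraph G (pathGraph 4) ∧
    ¬ HasInducedSubgraph G (cycleGraph 4)

/-- The set `X` admits a nested neighborhood ordering in `G`: there is an enumeration
`(v 1, …, v k)` of `X` with `N(v 1) \ X ⊆ N(v 2) \ X ⊆ … ⊆ N(v k) \ X`. -/
def HasNNO {V : Type*} (G : SimpleGraph V) (X : Set V) : Prop :=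
  ∃ l : List V, l.Nodup ∧ {a | a ∈ l} = X ∧
    l.Chain' fun a b => G.neighborSet a \ X ⊆ G.neighborSet b \ X

/-- Comparability of outer neighborhoods is equivalent to the existence of a nested neighborhood
ordering. -/
theorem hasNNO_iff_comparable {V : Type*} [Finite V] (G : SimpleGraph V) (X : Set V) :
    HasNNO G X ↔ ∀ a ∈ X, ∀ b ∈ X, G.neighborSet a \ X ⊆ G.neighborSet b \ X ∨
      G.neighborSet b \ X ⊆ G.neighborSet a \ X := by
  constructor
  · rintro ⟨l, -, rfl, hl⟩ a ha b hb
    have htrans : IsTrans V fun a b =>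
        G.neighborSet a \ {x | x ∈ l} ⊆ G.neighborSet b \ {x | x ∈ l} :=
      ⟨fun _ _ _ => Set.Subset.trans⟩
    let r : V → V → Prop := fun a b =>
      G.neighborSet a \ {x | x ∈ l} ⊆ G.neighborSet b \ {x | x ∈ l} ∨
        G.neighborSet b \ {x | x ∈ l} ⊆ G.neighborSet a \ {x | x ∈ l}
    have hsymm : Std.Symm r := ⟨fun _ _ => Or.symm⟩
    have hpair : l.Pairwise r := (List.isChain_iff_pairwise.mp hl).imp Or.inl
    exact hpair.forall_of_forall (R := r) (fun _ _ => Or.inl subset_rfl) ha hb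
  · intro h
    classical
    have := Fintype.ofFinite V
    let r : V → V → Prop := fun a b =>
      (G.neighborSet a \ X).ncard ≤ (G.neighborSet b \ X).ncard
    have : Std.Total r := ⟨fun _ _ => le_total _ _⟩
    have : IsTrans V r := ⟨fun _ _ _ => le_trans⟩
    have hmem : ∀ x, x ∈ X.toFinset.toList.insertionSort r ↔ x ∈ X := by simp
    refine ⟨X.toFinset.toList.insertionSort r, ?_, Set.ext hmem, ?_⟩
    · exact (List.perm_insertionSort r _).nodup_iff.mpr (Finset.nodup_toList _)
    · refine ((List.pairwise_insertionSort r _).imp_of_mem fun {a b} ha hb hab => ?_).isChain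
      rcases h a ((hmem a).mp ha) b ((hmem b).mp hb) with hs | hs
      · exact hs
      · exact (Set.eq_of_subset_of_ncard_le hs hab (Set.toFinite _)).superset

/-- Containing an induced copy of `H` amounts to the existence of a graph embedding of `H`. -/
theorem hasInducedSubgraph_iff_nonempty_embedding {V W : Type*} (G : SimpleGraph V)
    (H : SimpleGraph W) : HasInducedSubgraph G H ↔ Nonempty (H ↪g G) := by
  constructor
  · rintro ⟨s, ⟨e⟩⟩
    exact ⟨(SimpleGraph.Embedding.induce s).comp e.symm.toEmbedding⟩
  · rintro ⟨f⟩
    exact ⟨Set.range f, ⟨(SimpleGraph.Embedding.isoInduceRange f).symm⟩⟩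

/-- A graph without alternating 4-cycles is a threshold graph. -/
theorem isThreshold_of_no_alternating {V : Type*} (G : SimpleGraph V)
    (h : ∀ a b c d : V, G.Adj a b → G.Adj c d → a ≠ d → b ≠ c → G.Adj a d ∨ G.Adj b c) :
    IsThreshold G := by
  have key : ∀ H : SimpleGraph (Fin 4), (∃ a b c d, H.Adj a b ∧ H.Adj c d ∧ a ≠ d ∧ b ≠ c ∧
      ¬ H.Adj a d ∧ ¬ H.Adj b c) → ¬ HasInducedSubgraph G H := by
    rintro H ⟨a, b, c, d, hab, hcd, had, hbc, nad, nbc⟩ hH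
    obtain ⟨f⟩ := (hasInducedSubgraph_iff_nonempty_embedding G H).mp hH
    rcases h (f a) (f b) (f c) (f d) (f.map_adj_iff.mpr hab) (f.map_adj_iff.mpr hcd)
      (f.injective.ne had) (f.injective.ne hbc) with h | h
    · exact nad (f.map_adj_iff.mp h)
    · exact nbc (f.map_adj_iff.mp h)
  refine ⟨key _ ⟨0, 1, 2, 3, ?_⟩, key _ ⟨0, 1, 3, 2, ?_⟩, key _ ⟨0, 1, 3, 2, ?_⟩⟩
  · simp [twoK2]
  · simp [pathGraph_adj]
  · simp only [cycleGraph_adj]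
    decide

/-- An induced path on four vertices prevents a graph from being threshold. -/
theorem IsThreshold.not_induced_path {V : Type*} {G : SimpleGraph V} (hG : IsThreshold G)
    {a b c d : V} (hab : G.Adj a b) (hbc : G.Adj b c) (hcd : G.Adj c d) (hac : ¬ G.Adj a c)
    (hbd : ¬ G.Adj b d) (had : ¬ G.Adj a d) : False := by
  have hne : a ≠ d := by
    rintro rfl
    exact hac hcd.symm
  have hne' : a ≠ c := by
    rintro rfl
    exact had hcd
  have hne'' : b ≠ d := by
    rintro rfl
    exact had hab
  refine hG.2.1 ((hasInducedSubgraph_iff_nonempty_embedding _ _).mpr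
    ⟨⟨⟨![a, b, c, d], ?_⟩, ?_⟩⟩)
  · intro i j
    fin_cases i <;> fin_cases j <;>
      simp [hne, hne', hne'', hne.symm, hne'.symm, hne''.symm, hab.ne, hbc.ne, hcd.ne,
        hab.ne', hbc.ne', hcd.ne']
  · intro i j
    change G.Adj (![a, b, c, d] i) (![a, b, c, d] j) ↔ _
    fin_cases i <;> fin_cases j <;>
      simp [pathGraph_adj, hab, hbc, hcd, hac, hbd, had, hab.symm, hbc.symm, hcd.symm,
        G.adj_comm d, G.adj_comm c a]

/-- Let `G` be a finite simple bipartite graph with bipartition `(U, W)` and let `G'` be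
the graph obtained from `G` by adding all edges between distinct vertices of `U`.  Then
`U` admits a nested neighborhood ordering in `G` (i.e. `G` is a bipartite chain graph
with this bipartition) if and only if `G'` is a threshold graph. -/
theorem bipartite_nno_iff_completion_isThreshold {V : Type*} [Fintype V]
    (G : SimpleGraph V) (U W : Set V) (hpart : U ∪ W = Set.univ) (hdisj : Disjoint U W)
    (hbip : ∀ a b : V, G.Adj a b → (a ∈ U ∧ b ∈ W) ∨ (a ∈ W ∧ b ∈ U)) :
    HasNNO G U ↔ IsThreshold (G ⊔ SimpleGraph.fromRel fun a b => a ∈ U ∧ b ∈ U) := by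
  rw [hasNNO_iff_comparable]
  have hW : ∀ x, x ∉ U ↔ x ∈ W := fun x =>
    ⟨fun hx => (hpart.ge (Set.mem_univ x)).resolve_left hx,
      fun hx hU => Set.disjoint_left.mp hdisj hU hx⟩
  have hadj : ∀ a b, (G ⊔ SimpleGraph.fromRel fun a b => a ∈ U ∧ b ∈ U).Adj a b ↔
      G.Adj a b ∨ a ≠ b ∧ a ∈ U ∧ b ∈ U := by
    intro a b
    simp only [sup_adj, fromRel_adj]
    tauto
  constructor
  · intro h
    have hcross : ∀ a b c d : V, a ∈ U → c ∈ U → b ∉ U → d ∉ U → G.Adj a b → G.Adj c d →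
        G.Adj a d ∨ G.Adj b c := by
      intro a b c d ha hc hb hd hab hcd
      rcases h a ha c hc with hs | hs
      · exact Or.inr (hs ⟨hab, hb⟩).1.symm
      · exact Or.inl (hs ⟨hcd, hd⟩).1
    refine isThreshold_of_no_alternating _ fun a b c d hab hcd had hbc => ?_
    simp only [hadj] at *
    have h₁ := hbip a b
    have h₂ := hbip c d
    have h₃ := hcross a b c d
    have h₄ := hcross b a d c
    simp only [← hW] at h₁ h₂
    grind [G.adj_comm a b, G.adj_comm c d, G.adj_comm a d, G.adj_comm b c]
  · intro hT a ha c hc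
    by_contra! hcon
    obtain ⟨b, ⟨hab, hb⟩, hcb⟩ := Set.not_subset.mp hcon.1
    obtain ⟨d, ⟨hcd, hd⟩, had⟩ := Set.not_subset.mp hcon.2
    replace hab : G.Adj a b := hab
    replace hcd : G.Adj c d := hcd
    replace hcb : ¬ G.Adj c b := fun h => hcb ⟨h, hb⟩
    replace had : ¬ G.Adj a d := fun h => had ⟨h, hd⟩
    have hac : a ≠ c := by
      rintro rfl
      exact hcb hab
    have hbd : ¬ G.Adj b d := fun h => (hbip b d h).elim (fun h => hb h.1) fun h => hd h.2
    refine hT.not_induced_path (a := b) (b := a) (c := c) (d := d) ?_ ?_ ?_ ?_ ?_ ?_ <;>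
      rw [hadj]
    · exact Or.inl hab.symm
    · exact Or.inr ⟨hac, ha, hc⟩
    · exact Or.inl hcd
    · exact fun h => h.elim (fun h => hcb h.symm) fun h => hb h.2.1
    · exact fun h => h.elim had fun h => hd h.2.2
    · exact fun h => h.elim hbd fun h => hb h.2.1
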